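/- For any function h : X → ℝ and any policy μ : X → U, the limsup average cost satisfies limsup_{T→∞} (1/(T+1)) Σ_{t=0}^{T} E[r(X(t), μ(X(t)))] ≤ max_{x ∈ X} ( r(x, μ(x)) + Σ_{y ∈ X} P(x, μ(x))(y) · h(y) − h(x) ), for every initial state x₀. -/

import Mathlib

open Filter Finset

/-- Distribution of the chain after `t` steps under kernel `K`, started at `x₀`:
the `t`-fold monadic bind of `K` applied to the point mass at `x₀`. -/
noncomputable def chainDist {X : Type*} (K : X → PMF X) (x₀ : X) : ℕ → PMF X
  | 0 => PMF.pure x₀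
  | t + 1 => (chainDist K x₀ t).bind K

/-- Expectation of `f` under a PMF on a finite type. -/
noncomputable def pmfExp {X : Type*} [Fintype X] (q : PMF X) (f : X → ℝ) : ℝ :=
  ∑ x, (q x).toReal * f x

/-- The average cost over periods `0,…,T` of running the Markov chain with step
kernel `K` and per-stage cost `c`, started at `x₀`. -/
noncomputable def avgCost {X : Type*} [Fintype X] (K : X → PMF X) (c : X → ℝ)
    (x₀ : X) (T : ℕ) : ℝ :=
  (1 / (T + 1 : ℝ)) * ∑ t ∈ Finset.range (T + 1), pmfExp (chainDist K x₀ t) c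

section PmfExp

variable {X : Type*} [Fintype X]

theorem pmfExp_const (q : PMF X) (a : ℝ) : pmfExp q (fun _ => a) = a := by
  have hsum : ∑ x, (q x).toReal = 1 := by
    rw [← ENNReal.toReal_sum fun x _ => q.apply_ne_top x, ← tsum_fintype (L := .unconditional X),
      q.tsum_coe, ENNReal.toReal_one]
  rw [pmfExp, ← Finset.sum_mul, hsum, one_mul]

theorem pmfExp_mono (q : PMF X) {f g : X → ℝ} (hfg : ∀ x, f x ≤ g x) : pmfExp q f ≤ pmfExp q g :=
  Finset.sum_le_sum fun x _ => mul_le_mul_of_nonneg_left (hfg x) ENNReal.toReal_nonneg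

theorem pmfExp_add (q : PMF X) (f g : X → ℝ) :
    pmfExp q (fun x => f x + g x) = pmfExp q f + pmfExp q g := by
  simp only [pmfExp, mul_add, Finset.sum_add_distrib]

theorem pmfExp_sub (q : PMF X) (f g : X → ℝ) :
    pmfExp q (fun x => f x - g x) = pmfExp q f - pmfExp q g := by
  simp only [pmfExp, mul_sub, Finset.sum_sub_distrib]

theorem pmfExp_bind (q : PMF X) (K : X → PMF X) (f : X → ℝ) :
    pmfExp (q.bind K) f = pmfExp q (fun x => pmfExp (K x) f) := by
  have hbind (y : X) : (q.bind K y).toReal = ∑ x, (q x).toReal * (K x y).toReal := by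
    rw [PMF.bind_apply, tsum_fintype, ENNReal.toReal_sum fun x _ =>
      ENNReal.mul_ne_top (q.apply_ne_top x) ((K x).apply_ne_top y)]
    simp only [ENNReal.toReal_mul]
  simp only [pmfExp, hbind, Finset.sum_mul, Finset.mul_sum, mul_assoc]
  exact Finset.sum_comm

/-- Telescoping form of the drift inequality. -/
theorem sum_pmfExp_chainDist_le (K : X → PMF X) (c h : X → ℝ) (x₀ : X) {M : ℝ}
    (hM : ∀ x, c x + pmfExp (K x) h - h x ≤ M) (n : ℕ) :
    ∑ t ∈ Finset.range n, pmfExp (chainDist K x₀ t) c ≤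
      n * M + pmfExp (chainDist K x₀ 0) h - pmfExp (chainDist K x₀ n) h := by
  induction n with
  | zero => simp
  | succ n ih =>
    have hstep := pmfExp_mono (chainDist K x₀ n) hM
    rw [pmfExp_const, pmfExp_sub, pmfExp_add, ← pmfExp_bind, ← chainDist] at hstep
    rw [Finset.sum_range_succ]
    push_cast
    linarith

theorem avgCost_le (K : X → PMF X) (c h : X → ℝ) (x₀ : X) {M b : ℝ}
    (hM : ∀ x, c x + pmfExp (K x) h - h x ≤ M) (hb : ∀ x, b ≤ h x) (T : ℕ) :
    avgCost K c x₀ T ≤ M + (pmfExp (chainDist K x₀ 0) h - b) * (1 / ((T : ℝ) + 1)) := by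
  have hT : (0 : ℝ) < T + 1 := by positivity
  have hsum := sum_pmfExp_chainDist_le K c h x₀ hM (T + 1)
  have hlow := pmfExp_mono (chainDist K x₀ (T + 1)) hb
  rw [pmfExp_const] at hlow
  rw [avgCost, one_div_mul_eq_div, div_le_iff₀ hT, add_mul, mul_assoc, one_div_mul_cancel hT.ne']
  push_cast at hsum
  linarith

theorem le_avgCost (K : X → PMF X) (c : X → ℝ) (x₀ : X) {b : ℝ} (hb : ∀ x, b ≤ c x) (T : ℕ) :
    b ≤ avgCost K c x₀ T := by
  have hT : (0 : ℝ) < T + 1 := by positivity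
  have hsum := Finset.card_nsmul_le_sum (Finset.range (T + 1))
    (fun t => pmfExp (chainDist K x₀ t) c) b fun t _ =>
      (pmfExp_const (chainDist K x₀ t) b).symm.le.trans (pmfExp_mono _ hb)
  rw [avgCost, one_div_mul_eq_div, le_div_iff₀ hT, mul_comm]
  simpa using hsum

end PmfExp

theorem limsup_avg_cost_le_max_cost_plus_drift
    {X U : Type*} [Fintype X] [Nonempty X] [Fintype U] [Nonempty U]
    (r : X → U → ℝ) (P : X → U → PMF X) (h : X → ℝ) (μ : X → U) (x₀ : X) :
    limsup (avgCost (fun x => P x (μ x)) (fun x => r x (μ x)) x₀) atTop ≤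
      Finset.univ.sup' Finset.univ_nonempty
        (fun x => r x (μ x) + (∑ y, ((P x (μ x)) y).toReal * h y) - h x) := by
  set K : X → PMF X := fun x => P x (μ x)
  set c : X → ℝ := fun x => r x (μ x)
  set M : ℝ := Finset.univ.sup' Finset.univ_nonempty
    (fun x => c x + (∑ y, (K x y).toReal * h y) - h x)
  have hM (x : X) : c x + pmfExp (K x) h - h x ≤ M :=
    Finset.le_sup' (fun x => c x + (∑ y, (K x y).toReal * h y) - h x) (Finset.mem_univ x)
  obtain ⟨xh, hxh⟩ := Finite.exists_min h
  obtain ⟨xc, hxc⟩ := Finite.exists_min c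
  have hlim : Tendsto (fun T : ℕ => M + (pmfExp (chainDist K x₀ 0) h - h xh) *
      (1 / ((T : ℝ) + 1))) atTop (nhds M) := by
    simpa using (tendsto_one_div_add_atTop_nhds_zero_nat (𝕜 := ℝ)).const_mul
      (pmfExp (chainDist K x₀ 0) h - h xh) |>.const_add M
  rw [← hlim.limsup_eq]
  exact limsup_le_limsup (Eventually.of_forall (avgCost_le K c h x₀ hM hxh))
    (isBoundedUnder_of ⟨c xc, le_avgCost K c x₀ hxc⟩).isCoboundedUnder_le
    hlim.isBoundedUnder_le
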